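/- Let f ∈ S*(e^z), i.e., f is a normalized analytic function on 𝔻 with z f'(z)/f(z) ≺ e^z. Then the pre-Schwarzian norm of f satisfies ||P_f|| ≤ (1 − α²)(e^{α} + α − 1)/α, where α is the unique root in (0,1) of the equation 1 + r² − 2r³ − e^{r}(1 − r + r² + r³) = 0. -/

import Mathlib

open Metric Set

noncomputable section

/-- The open unit disk in the complex plane. -/
def unitDisk : Set ℂ := Metric.ball 0 1

/-- A function is normalized if it is analytic on the unit disk with f(0)=0 and f'(0)=1. -/
def IsNormalized (f : ℂ → ℂ) : Prop :=
  AnalyticOnNhd ℂ f unitDisk ∧ f 0 = 0 ∧ deriv f 0 = 1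

/-- Subordination: f ≺ g on the unit disk. -/
def Subord (f g : ℂ → ℂ) : Prop :=
  ∃ ω : ℂ → ℂ, AnalyticOnNhd ℂ ω unitDisk ∧ ω 0 = 0 ∧
    Set.MapsTo ω unitDisk unitDisk ∧ Set.EqOn f (g ∘ ω) unitDisk

/-- The quantity z f'(z)/f(z), extended by its analytic value 1 at z = 0. -/
def sratio (f : ℂ → ℂ) (z : ℂ) : ℂ := if z = 0 then 1 else z * deriv f z / f z

/-- The Ma-Minda starlike class S*(φ). -/
def MemSstar (φ f : ℂ → ℂ) : Prop :=
  IsNormalized f ∧ (∀ z ∈ unitDisk, z ≠ 0 → f z ≠ 0) ∧ Subord (sratio f) φ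

/-- The Ma-Minda convex class C(φ). -/
def MemC (φ g : ℂ → ℂ) : Prop :=
  IsNormalized g ∧ (∀ z ∈ unitDisk, deriv g z ≠ 0) ∧
    Subord (fun z => 1 + z * deriv (deriv g) z / deriv g z) φ

/-- The set of values (1-|z|²)|P_f(z)|, z ∈ 𝔻, whose supremum is the pre-Schwarzian norm. -/
def pSVals (f : ℂ → ℂ) : Set ℝ :=
  {x : ℝ | ∃ z ∈ unitDisk, x = (1 - ‖z‖^2) * ‖deriv (deriv f) z / deriv f z‖}

open Filter Topology ComplexConjugate

/-- The disk automorphism sending `0` to `a`. -/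
def diskShift (a u : ℂ) : ℂ := (u + a) / (1 + conj a * u)

lemma one_add_conj_mul_ne_zero {a u : ℂ} (ha : ‖a‖ < 1) (hu : ‖u‖ < 1) :
    1 + conj a * u ≠ 0 := by
  intro h
  have h1 : ‖conj a * u‖ = 1 := by
    rw [eq_neg_of_add_eq_zero_right h, norm_neg, norm_one]
  rw [norm_mul, RCLike.norm_conj] at h1
  nlinarith [norm_nonneg a, norm_nonneg u]

lemma norm_diskShift_lt_one {a u : ℂ} (ha : ‖a‖ < 1) (hu : ‖u‖ < 1) :
    ‖diskShift a u‖ < 1 := by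
  have hne := one_add_conj_mul_ne_zero ha hu
  rw [diskShift, norm_div, div_lt_one (norm_pos_iff.mpr hne)]
  refine lt_of_pow_lt_pow_left₀ 2 (norm_nonneg _) ?_
  have key : ‖1 + conj a * u‖ ^ 2 - ‖u + a‖ ^ 2 = (1 - ‖a‖ ^ 2) * (1 - ‖u‖ ^ 2) := by
    simp only [Complex.sq_norm, Complex.normSq_apply, Complex.add_re, Complex.add_im,
      Complex.mul_re, Complex.mul_im, Complex.conj_re, Complex.conj_im, Complex.one_re,
      Complex.one_im]
    ring
  have : 0 < (1 - ‖a‖ ^ 2) * (1 - ‖u‖ ^ 2) := by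
    apply mul_pos <;> nlinarith [norm_nonneg a, norm_nonneg u]
  linarith

lemma hasDerivAt_diskShift {a u : ℂ} (h : 1 + conj a * u ≠ 0) :
    HasDerivAt (diskShift a) ((1 - conj a * a) / (1 + conj a * u) ^ 2) u := by
  have h1 : HasDerivAt (fun u : ℂ => u + a) 1 u := (hasDerivAt_id u).add_const a
  have h2 : HasDerivAt (fun u : ℂ => 1 + conj a * u) (conj a) u := by
    simpa using ((hasDerivAt_id u).const_mul (conj a)).const_add 1
  refine (h1.div h2 h).congr_deriv ?_
  congr 1
  ring

/-- The infinitesimal **Schwarz–Pick lemma**. -/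
lemma schwarz_pick_deriv {w : ℂ → ℂ} (hw : DifferentiableOn ℂ w (ball 0 1))
    (hmaps : MapsTo w (ball 0 1) (ball 0 1)) {a : ℂ} (ha : a ∈ ball (0 : ℂ) 1) :
    (1 - ‖a‖ ^ 2) * ‖deriv w a‖ ≤ 1 - ‖w a‖ ^ 2 := by
  have ha' : ‖a‖ < 1 := by simpa using ha
  have hb : ‖-w a‖ < 1 := by simpa using hmaps ha
  have hshift : MapsTo (diskShift a) (ball 0 1) (ball 0 1) := fun u hu => by
    simpa using norm_diskShift_lt_one ha' (by simpa using hu)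
  have hd1 : DifferentiableOn ℂ (diskShift a) (ball 0 1) := fun u hu =>
    (hasDerivAt_diskShift (one_add_conj_mul_ne_zero ha'
      (by simpa using hu))).differentiableAt.differentiableWithinAt
  have hd2 : DifferentiableOn ℂ (diskShift (-w a)) (ball 0 1) := fun u hu =>
    (hasDerivAt_diskShift (one_add_conj_mul_ne_zero hb
      (by simpa using hu))).differentiableAt.differentiableWithinAt
  have h0 : diskShift a 0 = a := by simp [diskShift]
  have hwa : diskShift (-w a) (w a) = 0 := by simp [diskShift]
  have hmapsg : MapsTo (diskShift (-w a) ∘ w ∘ diskShift a) (ball 0 1)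
      (closedBall ((diskShift (-w a) ∘ w ∘ diskShift a) 0) 1) := fun u hu => by
    have h1 : ‖w (diskShift a u)‖ < 1 := by simpa using hmaps (hshift hu)
    simpa [h0, hwa] using (norm_diskShift_lt_one hb h1).le
  have hle := Complex.norm_deriv_le_div_of_mapsTo_ball
    (hd2.comp (hw.comp hd1 hshift) (hmaps.comp hshift)) hmapsg one_pos
  have hderw : HasDerivAt w (deriv w a) a :=
    (hw.differentiableAt (isOpen_ball.mem_nhds ha)).hasDerivAt
  have hder1 := hasDerivAt_diskShift (a := a) (u := 0) (by simp)
  have hder2 := hasDerivAt_diskShift (a := -w a) (u := w a)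
    (one_add_conj_mul_ne_zero hb (by simpa using hb))
  have hderw' : HasDerivAt w (deriv w a) (diskShift a 0) := by rwa [h0]
  have hder12 : HasDerivAt (w ∘ diskShift a) _ 0 := hderw'.comp 0 hder1
  have hder : HasDerivAt (diskShift (-w a) ∘ w ∘ diskShift a) _ 0 :=
    HasDerivAt.comp (h₂ := diskShift (-w a)) 0 (by simpa [h0] using hder2) hder12
  rw [hder.deriv] at hle
  have hbpos : 0 < 1 - ‖w a‖ ^ 2 := by
    rw [norm_neg] at hb; nlinarith [norm_nonneg (w a)]
  have hapos : 0 < 1 - ‖a‖ ^ 2 := by nlinarith [norm_nonneg a]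
  have one_sub_conj_mul : ∀ c : ℂ, 1 - conj c * c = ((1 - ‖c‖ ^ 2 : ℝ) : ℂ) := fun c => by
    rw [Complex.conj_mul']; push_cast; ring
  simp only [mul_zero, add_zero, one_pow, div_one, ← sub_eq_add_neg, one_sub_conj_mul,
    norm_mul, norm_div, norm_pow, Complex.norm_of_nonneg hapos.le,
    Complex.norm_of_nonneg hbpos.le] at hle
  have h3 : (1 - ‖w a‖ ^ 2) / (1 - ‖w a‖ ^ 2) ^ 2 = (1 - ‖w a‖ ^ 2)⁻¹ := by
    field_simp
  rw [h3, inv_mul_le_iff₀ hbpos] at hle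
  linarith

lemma norm_exp_sub_one_le_exp_norm_sub_one (x : ℂ) :
    ‖Complex.exp x - 1‖ ≤ Real.exp ‖x‖ - 1 := by
  simpa using Complex.norm_exp_sub_sum_le_exp_norm_sub_sum x 1

/-- The numerator of the derivative of `extremalBound`. -/
def criticalFun (s : ℝ) : ℝ := 1 + s ^ 2 - 2 * s ^ 3 - Real.exp s * (1 - s + s ^ 2 + s ^ 3)

/-- The factor of the derivative of `criticalFun` that decides its sign. -/
def criticalFactor (s : ℝ) : ℝ := 2 - 6 * s - Real.exp s * (1 + 4 * s + s ^ 2)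

/-- The bound for the pre-Schwarzian in terms of the modulus `s` of the subordinating function. -/
def extremalBound (s : ℝ) : ℝ := (1 - s ^ 2) * (Real.exp s + s - 1) / s

lemma criticalFactor_lt {x y : ℝ} (hx : 0 ≤ x) (hxy : x < y) :
    criticalFactor y < criticalFactor x := by
  have h1 : Real.exp x * (1 + 4 * x + x ^ 2) ≤ Real.exp y * (1 + 4 * y + y ^ 2) := by gcongr
  unfold criticalFactor
  linarith

lemma hasDerivAt_criticalFun (s : ℝ) :
    HasDerivAt criticalFun (s * criticalFactor s) s := by
  have h1 : HasDerivAt (fun s : ℝ => 1 + s ^ 2 - 2 * s ^ 3) (2 * s - 6 * s ^ 2) s := by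
    refine ((((hasDerivAt_pow 2 s).const_add 1).sub
      ((hasDerivAt_pow 3 s).const_mul 2))).congr_deriv ?_
    norm_num; ring
  have h2 : HasDerivAt (fun s : ℝ => 1 - s + s ^ 2 + s ^ 3) (-1 + 2 * s + 3 * s ^ 2) s := by
    refine ((((hasDerivAt_id s).const_sub 1).add (hasDerivAt_pow 2 s)).add
      (hasDerivAt_pow 3 s)).congr_deriv ?_
    norm_num
  refine (h1.sub ((Real.hasDerivAt_exp s).mul h2)).congr_deriv ?_
  unfold criticalFactor
  ring

lemma exists_criticalFactor_eq {a b : ℝ} (hab : a < b) :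
    ∃ c ∈ Ioo a b, c * criticalFactor c = (criticalFun b - criticalFun a) / (b - a) :=
  exists_hasDerivAt_eq_slope criticalFun (fun s => s * criticalFactor s) hab
    (fun x _ => (hasDerivAt_criticalFun x).continuousAt.continuousWithinAt)
    (fun x _ => hasDerivAt_criticalFun x)

lemma criticalFun_zero : criticalFun 0 = 0 := by simp [criticalFun]

lemma criticalFun_nonneg {α s : ℝ} (hroot : criticalFun α = 0) (hs : 0 < s) (hsα : s < α) :
    0 ≤ criticalFun s := by
  by_contra! h
  obtain ⟨x, ⟨hx0, hxs⟩, hx⟩ := exists_criticalFactor_eq hs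
  obtain ⟨y, ⟨hys, -⟩, hy⟩ := exists_criticalFactor_eq hsα
  rw [criticalFun_zero] at hx
  rw [hroot] at hy
  have h1 : x * criticalFactor x < 0 := hx ▸ div_neg_of_neg_of_pos (by linarith) (by linarith)
  have h2 : 0 < y * criticalFactor y := hy ▸ div_pos (by linarith) (by linarith)
  have h3 := criticalFactor_lt hx0.le (hxs.trans hys)
  have h4 : 0 < criticalFactor y := pos_of_mul_pos_right h2 (by linarith)
  nlinarith

lemma criticalFun_nonpos {α s : ℝ} (hroot : criticalFun α = 0) (hα : 0 < α) (hsα : α < s) :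
    criticalFun s ≤ 0 := by
  by_contra! h
  obtain ⟨x, ⟨hx0, hxs⟩, hx⟩ := exists_criticalFactor_eq hα
  obtain ⟨y, ⟨hys, -⟩, hy⟩ := exists_criticalFactor_eq hsα
  rw [criticalFun_zero, hroot, sub_self, zero_div] at hx
  rw [hroot] at hy
  have h1 : criticalFactor x = 0 := (mul_eq_zero.mp hx).resolve_left hx0.ne'
  have h2 : 0 < y * criticalFactor y := hy ▸ div_pos (by linarith) (by linarith)
  have h3 := criticalFactor_lt hx0.le (hxs.trans hys)
  have h4 : 0 < criticalFactor y := pos_of_mul_pos_right h2 (by linarith)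
  linarith

lemma hasDerivAt_extremalBound {s : ℝ} (hs : s ≠ 0) :
    HasDerivAt extremalBound (criticalFun s / s ^ 2) s := by
  have h1 : HasDerivAt (fun s : ℝ => 1 - s ^ 2) (-(2 * s)) s := by
    simpa using (hasDerivAt_pow 2 s).const_sub 1
  have h2 : HasDerivAt (fun s : ℝ => Real.exp s + s - 1) (Real.exp s + 1) s :=
    ((Real.hasDerivAt_exp s).add (hasDerivAt_id s)).sub_const 1
  refine ((h1.mul h2).div (hasDerivAt_id s) hs).congr_deriv ?_
  simp only [criticalFun, id, Pi.mul_apply]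
  congr 1
  ring

lemma extremalBound_le {α s : ℝ} (hα : 0 < α) (hroot : criticalFun α = 0) (hs : 0 < s) :
    extremalBound s ≤ extremalBound α := by
  have hcont : ∀ {a b : ℝ}, 0 < a → ContinuousOn extremalBound (Icc a b) := fun ha x hx =>
    (hasDerivAt_extremalBound (ha.trans_le hx.1).ne').continuousAt.continuousWithinAt
  rcases le_total s α with h | h
  · refine monotoneOn_of_deriv_nonneg (convex_Icc s α) (hcont hs) ?_ ?_ (left_mem_Icc.2 h)
      (right_mem_Icc.2 h) h
    · intro x hx
      rw [interior_Icc] at hx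
      exact (hasDerivAt_extremalBound
        (hs.trans hx.1).ne').differentiableAt.differentiableWithinAt
    · intro x hx
      rw [interior_Icc] at hx
      rw [(hasDerivAt_extremalBound (hs.trans hx.1).ne').deriv]
      exact div_nonneg (criticalFun_nonneg hroot (hs.trans hx.1) hx.2) (sq_nonneg x)
  · refine antitoneOn_of_deriv_nonpos (convex_Icc α s) (hcont hα) ?_ ?_ (left_mem_Icc.2 h)
      (right_mem_Icc.2 h) h
    · intro x hx
      rw [interior_Icc] at hx
      exact (hasDerivAt_extremalBound
        (hα.trans hx.1).ne').differentiableAt.differentiableWithinAt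
    · intro x hx
      rw [interior_Icc] at hx
      rw [(hasDerivAt_extremalBound (hα.trans hx.1).ne').deriv]
      exact div_nonpos_of_nonpos_of_nonneg (criticalFun_nonpos hroot hα hx.1) (sq_nonneg x)

lemma one_le_extremalBound {α : ℝ} (hα : 0 < α) (hroot : criticalFun α = 0) :
    1 ≤ extremalBound α := by
  refine le_trans ?_ (extremalBound_le hα hroot (s := 1 / 2) (by norm_num))
  have := Real.add_one_le_exp (1 / 2 : ℝ)
  unfold extremalBound
  linarith

/-- Among radii `r ≥ s` the bound is largest at `r = s`. -/
lemma one_sub_sq_add_le {α s r : ℝ} (hα : 0 < α) (hroot : criticalFun α = 0) (hs : 0 ≤ s)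
    (hsr : s ≤ r) (hr : 0 < r) :
    1 - s ^ 2 + (1 - r ^ 2) * ((Real.exp s - 1) / r) ≤ extremalBound α := by
  rcases hs.eq_or_lt with rfl | hs
  · simpa using one_le_extremalBound hα hroot
  · refine le_trans ?_ (extremalBound_le hα hroot hs)
    have h1 : (1 - r ^ 2) / r ≤ (1 - s ^ 2) / s := by
      rw [div_le_div_iff₀ hr hs]
      nlinarith [mul_pos hr hs]
    have h2 : 0 ≤ Real.exp s - 1 := by linarith [Real.add_one_le_exp s]
    have h3 : extremalBound s = 1 - s ^ 2 + (1 - s ^ 2) / s * (Real.exp s - 1) := by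
      unfold extremalBound
      field_simp
      ring
    rw [h3, mul_div_assoc', mul_div_right_comm]
    gcongr

/-- The pre-Schwarzian of a starlike function in terms of its subordinating function. -/
lemma preSchwarzian_eq {f w : ℂ → ℂ} (hf : AnalyticOnNhd ℂ f unitDisk)
    (hne : ∀ z ∈ unitDisk, z ≠ 0 → f z ≠ 0) (hw : AnalyticOnNhd ℂ w unitDisk)
    (hfw : EqOn (sratio f) ((fun z => Complex.exp z) ∘ w) unitDisk) {z : ℂ}
    (hz : z ∈ unitDisk) (hz0 : z ≠ 0) :
    deriv (deriv f) z / deriv f z = deriv w z + (Complex.exp (w z) - 1) / z := by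
  have hderiv : ∀ u ∈ unitDisk, u ≠ 0 → deriv f u = f u * Complex.exp (w u) / u := by
    intro u hu hu0
    have h := hfw hu
    have hfu := hne u hu hu0
    simp only [sratio, hu0, if_false, Function.comp_apply] at h
    rw [← h]
    field_simp
  have hev : deriv f =ᶠ[𝓝 z] fun u => f u * Complex.exp (w u) / u := by
    filter_upwards [isOpen_ball.mem_nhds hz, isOpen_ne.mem_nhds hz0] with u hu hu0
    exact hderiv u hu hu0
  have hfd := (hf z hz).differentiableAt.hasDerivAt
  have hwd := (hw z hz).differentiableAt.hasDerivAt
  have hd : HasDerivAt (fun u => f u * Complex.exp (w u) / u) _ z :=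
    (hfd.mul hwd.cexp).div (hasDerivAt_id z) hz0
  have hfz := hne z hz hz0
  rw [hev.deriv_eq, hd.deriv, hderiv z hz hz0]
  simp only [Pi.mul_apply]
  field_simp
  ring

/-- Pre-Schwarzian norm estimate for the class S*(e^z). -/
theorem preSchwarzian_bound_Sstar_exp (f : ℂ → ℂ)
    (hf : MemSstar (fun z => Complex.exp z) f)
    (α : ℝ) (hα : α ∈ Set.Ioo (0:ℝ) 1)
    (hroot : 1 + α^2 - 2*α^3 - Real.exp α * (1 - α + α^2 + α^3) = 0) :
    ∀ z ∈ unitDisk, (1 - ‖z‖^2) * ‖deriv (deriv f) z / deriv f z‖ ≤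
      (1 - α^2) * (Real.exp α + α - 1) / α := by
  obtain ⟨⟨hfa, hf0, hf1⟩, hne, w, hw, hw0, hmaps, hfw⟩ := hf
  have punctured : ∀ z ∈ unitDisk, z ≠ 0 →
      (1 - ‖z‖ ^ 2) * ‖deriv (deriv f) z / deriv f z‖ ≤ extremalBound α := by
    intro z hz hz0
    have hz1 : ‖z‖ < 1 := by simpa [unitDisk] using hz
    have hpick := schwarz_pick_deriv hw.differentiableOn hmaps hz
    have hschwarz : ‖w z‖ ≤ ‖z‖ :=
      Complex.norm_le_norm_of_mapsTo_ball hw.differentiableOn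
        (hmaps.mono_right ball_subset_closedBall) hw0 hz1
    have hz2 : 0 ≤ 1 - ‖z‖ ^ 2 := by nlinarith [norm_nonneg z]
    rw [preSchwarzian_eq hfa hne hw hfw hz hz0]
    calc (1 - ‖z‖ ^ 2) * ‖deriv w z + (Complex.exp (w z) - 1) / z‖
        ≤ (1 - ‖z‖ ^ 2) * (‖deriv w z‖ + ‖Complex.exp (w z) - 1‖ / ‖z‖) := by
          rw [← norm_div]
          gcongr
          exact norm_add_le _ _
      _ ≤ (1 - ‖z‖ ^ 2) * (‖deriv w z‖ + (Real.exp ‖w z‖ - 1) / ‖z‖) := by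
          gcongr
          exact norm_exp_sub_one_le_exp_norm_sub_one _
      _ ≤ 1 - ‖w z‖ ^ 2 + (1 - ‖z‖ ^ 2) * ((Real.exp ‖w z‖ - 1) / ‖z‖) := by
          rw [mul_add]
          gcongr
      _ ≤ extremalBound α :=
          one_sub_sq_add_le hα.1 hroot (norm_nonneg _) hschwarz (norm_pos_iff.mpr hz0)
  intro z hz
  rcases eq_or_ne z 0 with rfl | hz0
  · have hcont : ContinuousAt
        (fun z => (1 - ‖z‖ ^ 2) * ‖deriv (deriv f) z / deriv f z‖) 0 := by
      have h1 := (hfa 0 hz).deriv.continuousAt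
      have h2 := (hfa 0 hz).deriv.deriv.continuousAt
      exact (by fun_prop : ContinuousAt (fun z : ℂ => 1 - ‖z‖ ^ 2) 0).mul
        (h2.div h1 (by simp [hf1])).norm
    refine le_of_tendsto (hcont.tendsto.mono_left (nhdsWithin_le_nhds (s := {0}ᶜ))) ?_
    filter_upwards [nhdsWithin_le_nhds (isOpen_ball.mem_nhds hz), self_mem_nhdsWithin]
      with u hu hu0
    exact punctured u hu hu0
  · exact punctured z hz hz0
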